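/- Let 1 < σ ≤ 1.15, set σ1 = 1/2 + (1/2)·√(1+4σ²), let k ∈ {1,2,3,4}, and let 0 < γ0 < 1. Then F(σ + i·k·γ0, 1) − κ·F(σ1 + i·k·γ0, 1) ≤ (σ−1)/((σ−1)² + (k·γ0)²) + 1.5166. -/

import Mathlib

namespace ZFR

noncomputable def kappa : ℝ := 1 / Real.sqrt 5

noncomputable def sigma1 (σ : ℝ) : ℝ := 1 / 2 + Real.sqrt (1 + 4 * σ ^ 2) / 2

/-- `F(s,z) = Re( 1/(s-z) + 1/(s-1+conj z) )`. -/
noncomputable def F (s z : ℂ) : ℝ :=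
  (1 / (s - z) + 1 / (s - 1 + (starRingEnd ℂ) z)).re

theorem F_one (x t : ℝ) :
    F ((x : ℂ) + (t : ℝ) * Complex.I) 1
      = (x - 1) / ((x - 1) ^ 2 + t ^ 2) + x / (x ^ 2 + t ^ 2) := by
  simp [F, Complex.normSq_apply, pow_two]

theorem F_one_nonneg {x : ℝ} (hx : 1 ≤ x) (t : ℝ) :
    0 ≤ F ((x : ℂ) + (t : ℝ) * Complex.I) 1 := by
  rw [F_one]
  have : 0 ≤ x - 1 := by linarith
  positivity

theorem one_le_sigma1 (σ : ℝ) : 1 ≤ sigma1 σ := by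
  have : 1 ≤ Real.sqrt (1 + 4 * σ ^ 2) := by
    rw [Real.one_le_sqrt]
    nlinarith [sq_nonneg σ]
  unfold sigma1
  linarith

theorem div_sq_add_sq_le_one {x : ℝ} (hx : 1 ≤ x) (t : ℝ) : x / (x ^ 2 + t ^ 2) ≤ 1 := by
  rw [div_le_one (by positivity)]
  nlinarith [sq_nonneg t]

/-- For `1 < σ ≤ 1.15`, `k ∈ {1,2,3,4}`, `0 < γ0 < 1`:
`F(σ+ikγ0,1) - κ F(σ1+ikγ0,1) ≤ (σ-1)/((σ-1)² + (kγ0)²) + 1.5166`. -/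
theorem pole_term_small_t (σ γ0 : ℝ) (hσ : 1 < σ) (hσ' : σ ≤ 1.15)
    (k : ℕ) (hk1 : 1 ≤ k) (hk4 : k ≤ 4) (hγ0 : 0 < γ0) (hγ1 : γ0 < 1) :
    F ((σ : ℂ) + ((k : ℝ) * γ0 : ℝ) * Complex.I) 1
        - kappa * F ((sigma1 σ : ℂ) + ((k : ℝ) * γ0 : ℝ) * Complex.I) 1
      ≤ (σ - 1) / ((σ - 1) ^ 2 + ((k : ℝ) * γ0) ^ 2) + 1.5166 := by
  have hκ : 0 ≤ kappa := by
    unfold kappa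
    positivity
  have h := mul_nonneg hκ (F_one_nonneg (one_le_sigma1 σ) ((k : ℝ) * γ0))
  have h' := div_sq_add_sq_le_one hσ.le ((k : ℝ) * γ0)
  rw [F_one σ]
  linarith

end ZFR
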